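/- (Stable recovery of global Basis Pursuit in the presence of noise.) Let D be a real N×M matrix with normalized columns d_1,…,d_M (‖d_j‖₂ = 1) and mutual coherence bound μ > 0 (|⟨d_i,d_j⟩| ≤ μ for i ≠ j). Let Γ ∈ ℝ^M with support T = supp(Γ), and suppose T satisfies the stripe overlap bound k: for every j ∈ T the number of t ∈ T with t ≠ j and ⟨d_t,d_j⟩ ≠ 0 is at most k − 1, and for every j ∉ T the number of t ∈ T with ⟨d_t,d_j⟩ ≠ 0 is at most k; assume k < (1/3)(1 + 1/μ). Let E ∈ ℝ^N satisfy |⟨d_j, E⟩| ≤ ε_L for every j ∈ {1,…,M}, set Y = DΓ + E and λ = 4ε_L, and let Γ_BP ∈ ℝ^M be a global minimizer of the Lagrangian Basis Pursuit objective F(v) = (1/2)‖Y − Dv‖₂² + λ‖v‖₁ over v ∈ ℝ^M. Then: (1) supp(Γ_BP) ⊆ supp(Γ); (2) ‖Γ_BP − Γ‖_∞ < (15/2)·ε_L; (3) every index i with |Γ_i| > (15/2)·ε_L belongs to supp(Γ_BP); and (4) the minimizer is unique, i.e. any global minimizer of F equals Γ_BP. -/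

import Mathlib

section DiagonalDominance

variable {ι : Type*} {G : ι → ι → ℝ} {T : Finset ι}

/-- A sum of absolute values of terms bounded by `μ`, at most `n` of which are nonzero,
is at most `n * μ`. -/
lemma sum_abs_le_natCard_mul (S : Finset ι) (f : ι → ℝ) (p : ι → Prop)
    (hp : ∀ t, p t ↔ t ∈ S ∧ f t ≠ 0) {μ : ℝ} (hf : ∀ t ∈ S, |f t| ≤ μ) :
    ∑ t ∈ S, |f t| ≤ Nat.card {t // p t} * μ := by
  have hcard : Nat.card {t // p t} = (S.filter fun t => f t ≠ 0).card := by
    exact Nat.subtype_card _ fun t => by simp [hp]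
  have hsum : ∑ t ∈ S.filter (fun t => f t ≠ 0), |f t| = ∑ t ∈ S, |f t| := by
    refine Finset.sum_subset (Finset.filter_subset _ _) fun t ht h => ?_
    simpa [ht] using h
  rw [hcard, ← hsum, ← nsmul_eq_mul]
  exact Finset.sum_le_card_nsmul _ _ _ fun t ht => hf t (Finset.mem_filter.1 ht).1

lemma sum_mul_eq_add_sum_erase [Fintype ι] [DecidableEq ι] (hdiag : ∀ i, G i i = 1) {a : ι → ℝ}
    (ha : ∀ i ∉ T, a i = 0) {i : ι} (hi : i ∈ T) :
    ∑ t, a t * G t i = a i + ∑ t ∈ T.erase i, a t * G t i := by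
  rw [← Finset.sum_subset (Finset.subset_univ T) fun t _ ht => by simp [ha t ht],
    ← Finset.add_sum_erase _ _ hi, hdiag, mul_one]

/-- A strictly diagonally dominant principal block is solvable. -/
lemma exists_supported_solution [Fintype ι] [DecidableEq ι] (hdiag : ∀ i, G i i = 1)
    (hdom : ∀ j ∈ T, ∑ t ∈ T.erase j, |G t j| < 1) (b : ι → ℝ) :
    ∃ a : ι → ℝ, (∀ i ∉ T, a i = 0) ∧ ∀ i ∈ T, ∑ t, a t * G t i = b i := by
  let A : Matrix T T ℝ := Matrix.of fun i t => G t i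
  have hdet : A.det ≠ 0 := by
    refine det_ne_zero_of_sum_row_lt_diag fun j => ?_
    have h := hdom j j.2
    rw [Finset.sum_erase_eq_sub j.2, hdiag] at h
    rw [Finset.sum_erase_eq_sub (Finset.mem_univ j)]
    simpa [A, hdiag, Finset.sum_attach T fun t => |G t j|] using h
  have hsol : A.mulVec (A⁻¹.mulVec fun i => b i) = fun i : T => b i := by
    rw [Matrix.mulVec_mulVec, Matrix.mul_nonsing_inv _ hdet.isUnit, Matrix.one_mulVec]
  set c := A⁻¹.mulVec fun i : T => b i
  refine ⟨fun i => if h : i ∈ T then c ⟨i, h⟩ else 0, fun i hi => by simp [hi], fun i hi => ?_⟩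
  rw [← congrFun hsol ⟨i, hi⟩,
    ← Finset.sum_subset (Finset.subset_univ T) fun t _ ht => by simp [ht],
    ← Finset.sum_coe_sort]
  exact Finset.sum_congr rfl fun t _ => by simp [A, mul_comm]

/-- Sup-norm bound for the inverse of a diagonally dominant principal block. -/
lemma abs_mul_one_sub_le [Fintype ι] [DecidableEq ι] (hdiag : ∀ i, G i i = 1) {ρ C : ℝ}
    (hρ : ρ < 1) (hdom : ∀ j ∈ T, ∑ t ∈ T.erase j, |G t j| ≤ ρ) {a : ι → ℝ}
    (ha : ∀ i ∉ T, a i = 0) (hC : ∀ i ∈ T, |∑ t, a t * G t i| ≤ C) :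
    ∀ i ∈ T, |a i| * (1 - ρ) ≤ C := by
  intro i hi
  obtain ⟨m, hm, hmax⟩ := T.exists_max_image (fun i => |a i|) ⟨i, hi⟩
  have hsum : |∑ t ∈ T.erase m, a t * G t m| ≤ |a m| * ρ := by
    calc |∑ t ∈ T.erase m, a t * G t m| ≤ ∑ t ∈ T.erase m, |a t * G t m| :=
          Finset.abs_sum_le_sum_abs _ _
      _ ≤ ∑ t ∈ T.erase m, |a m| * |G t m| := by
          refine Finset.sum_le_sum fun t ht => ?_
          rw [abs_mul]
          exact mul_le_mul_of_nonneg_right (hmax t (Finset.mem_of_mem_erase ht)) (abs_nonneg _)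
      _ ≤ |a m| * ρ := by
          rw [← Finset.mul_sum]
          exact mul_le_mul_of_nonneg_left (hdom m hm) (abs_nonneg _)
  have hCm := hC m hm
  rw [sum_mul_eq_add_sum_erase hdiag ha hm] at hCm
  have htri := abs_sub_abs_le_abs_sub (a m) (-∑ t ∈ T.erase m, a t * G t m)
  rw [sub_neg_eq_add, abs_neg] at htri
  have := mul_le_mul_of_nonneg_right (hmax i hi) (sub_pos.2 hρ).le
  linarith

/-- `ℓ¹` bound for the inverse of a symmetric diagonally dominant principal block. -/
lemma sum_abs_mul_one_sub_le [Fintype ι] [DecidableEq ι] (hdiag : ∀ i, G i i = 1)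
    (hsymm : ∀ i j, G i j = G j i) {ρ : ℝ} (hdom : ∀ j ∈ T, ∑ t ∈ T.erase j, |G t j| ≤ ρ)
    {a : ι → ℝ} (ha : ∀ i ∉ T, a i = 0) :
    (∑ i ∈ T, |a i|) * (1 - ρ) ≤ ∑ i ∈ T, |∑ t, a t * G t i| := by
  have hpoint : ∀ i ∈ T,
      |a i| ≤ |∑ t, a t * G t i| + ∑ t ∈ T.erase i, |a t| * |G t i| := by
    intro i hi
    have h : a i = ∑ t, a t * G t i - ∑ t ∈ T.erase i, a t * G t i := by
      rw [sum_mul_eq_add_sum_erase hdiag ha hi]; ring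
    calc |a i| ≤ |∑ t, a t * G t i| + |∑ t ∈ T.erase i, a t * G t i| := by
          conv_lhs => rw [h]
          exact abs_sub _ _
      _ ≤ _ := by
          gcongr
          simpa only [abs_mul] using
            Finset.abs_sum_le_sum_abs (fun t => a t * G t i) (T.erase i)
  have hswap : ∑ i ∈ T, ∑ t ∈ T.erase i, |a t| * |G t i|
      = ∑ t ∈ T, |a t| * ∑ i ∈ T.erase t, |G i t| := by
    simp_rw [Finset.mul_sum]
    rw [Finset.sum_comm' (t' := T) (s' := fun t => T.erase t)]
    · exact Finset.sum_congr rfl fun t _ => Finset.sum_congr rfl fun i _ => by rw [hsymm]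
    · intro x y
      simp only [Finset.mem_erase, ne_comm (a := x)]
      tauto
  have hoff : ∑ t ∈ T, |a t| * ∑ i ∈ T.erase t, |G i t| ≤ (∑ t ∈ T, |a t|) * ρ := by
    rw [Finset.sum_mul]
    exact Finset.sum_le_sum fun t ht => mul_le_mul_of_nonneg_left (hdom t ht) (abs_nonneg _)
  have := Finset.sum_le_sum hpoint
  rw [Finset.sum_add_distrib, hswap] at this
  linarith

end DiagonalDominance

section LeastSquares

variable {m n : Type*} [Fintype m] [Fintype n] (D : Matrix m n ℝ)

lemma sum_mul_mulVec (r : m → ℝ) (z : n → ℝ) :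
    ∑ x, r x * D.mulVec z x = ∑ i, z i * ∑ x, D x i * r x := by
  simp_rw [Matrix.mulVec, dotProduct, Finset.mul_sum]
  rw [Finset.sum_comm]
  exact Finset.sum_congr rfl fun i _ => Finset.sum_congr rfl fun x _ => by ring

lemma sum_mul_mulVec_eq_gram (p : n → ℝ) (i : n) :
    ∑ x, D x i * D.mulVec p x = ∑ t, p t * ∑ x, D x t * D x i :=
  sum_mul_mulVec D (fun x => D x i) p

lemma sum_sub_mulVec_add_sq (Y : m → ℝ) (v z : n → ℝ) :
    ∑ x, (Y x - D.mulVec (v + z) x) ^ 2 = ∑ x, (Y x - D.mulVec v x) ^ 2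
      - 2 * ∑ x, (Y x - D.mulVec v x) * D.mulVec z x + ∑ x, D.mulVec z x ^ 2 := by
  rw [Finset.mul_sum, ← Finset.sum_sub_distrib, ← Finset.sum_add_distrib]
  refine Finset.sum_congr rfl fun x _ => ?_
  rw [Matrix.mulVec_add, Pi.add_apply]
  ring

/-- Every minimizer of the `ℓ¹`-penalized least squares functional has residual correlations
bounded by the penalty parameter. -/
lemma abs_sum_mul_residual_le [DecidableEq n] (hnorm : ∀ j, ∑ x, D x j ^ 2 = 1)
    {Y : m → ℝ} {c : ℝ} (hc : 0 ≤ c) {v : n → ℝ}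
    (hmin : ∀ w, (1 / 2) * (∑ x, (Y x - D.mulVec v x) ^ 2) + c * ∑ i, |v i|
      ≤ (1 / 2) * (∑ x, (Y x - D.mulVec w x) ^ 2) + c * ∑ i, |w i|) (i : n) :
    |∑ x, D x i * (Y x - D.mulVec v x)| ≤ c := by
  set g := ∑ x, D x i * (Y x - D.mulVec v x)
  have key : ∀ s : ℝ, s * g ≤ s ^ 2 / 2 + c * |s| := by
    intro s
    have h := hmin (v + Pi.single i s)
    have hsq : ∑ x, D.mulVec (Pi.single i s) x ^ 2 = s ^ 2 := by
      simp [Matrix.mulVec_single, mul_pow, ← Finset.sum_mul, hnorm]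
    have hcross : ∑ x, (Y x - D.mulVec v x) * D.mulVec (Pi.single i s) x = s * g := by
      rw [sum_mul_mulVec, Finset.sum_eq_single i]
      · simp [g]
      · intro j _ hj; simp [hj]
      · simp
    have habs : ∑ j, |(v + Pi.single i s : n → ℝ) j| ≤ ∑ j, |v j| + |s| := by
      calc ∑ j, |(v + Pi.single i s : n → ℝ) j| ≤ ∑ j, (|v j| + |(Pi.single i s : n → ℝ) j|) :=
            Finset.sum_le_sum fun j _ => abs_add_le _ _
        _ = ∑ j, |v j| + |s| := by
            rw [Finset.sum_add_distrib, Finset.sum_eq_single (f := fun j => |(Pi.single i s : n → ℝ) j|) i]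
            · simp
            · intro j _ hj; simp [hj]
            · simp
    rw [sum_sub_mulVec_add_sq, hsq, hcross] at h
    nlinarith [mul_le_mul_of_nonneg_left habs hc]
  rw [abs_le]
  constructor
  · by_contra! hlt
    have h := key (g + c)
    rw [abs_of_neg (by linarith)] at h
    nlinarith [sq_pos_of_neg (show g + c < 0 by linarith)]
  · by_contra! hlt
    have h := key (g - c)
    rw [abs_of_pos (by linarith)] at h
    nlinarith [sq_pos_of_pos (show 0 < g - c by linarith)]

end LeastSquares

/-- Stable recovery of global Basis Pursuit in the presence of noise (Theorem 5): if
`T = supp(Γ)` has stripe overlap bound `k` with `k < (1/3)(1 + 1/μ)`, `Y = DΓ + E` with local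
noise correlations bounded by `ε_L`, and `Γ_BP` is a global minimizer of the Lagrangian Basis
Pursuit objective `F(v) = (1/2)‖Y - Dv‖₂² + 4ε_L‖v‖₁`, then: the support of `Γ_BP` is
contained in that of `Γ`; `‖Γ_BP - Γ‖_∞ < (15/2)ε_L`; every index with `|Γ_i| > (15/2)ε_L`
is in the support of `Γ_BP`; and the minimizer is unique. -/
theorem bp_stable_recovery {N M : ℕ} (D : Matrix (Fin N) (Fin M) ℝ)
    (μ εL : ℝ) (k : ℕ) (hμ : 0 < μ) (hεL : 0 < εL)
    (hnorm : ∀ j, (∑ x, D x j ^ 2) = 1)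
    (hcoh : ∀ i j, i ≠ j → |∑ x, D x i * D x j| ≤ μ)
    (Γ : Fin M → ℝ) (T : Finset (Fin M)) (hT : ∀ i, Γ i ≠ 0 ↔ i ∈ T)
    (hin : ∀ j ∈ T,
      Nat.card {t : Fin M // t ∈ T ∧ t ≠ j ∧ (∑ x, D x t * D x j) ≠ 0} < k)
    (hout : ∀ j ∉ T,
      Nat.card {t : Fin M // t ∈ T ∧ (∑ x, D x t * D x j) ≠ 0} ≤ k)
    (hk : (k : ℝ) < (1 / 3) * (1 + 1 / μ))
    (E Y : Fin N → ℝ)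
    (hE : ∀ j, |∑ x, D x j * E x| ≤ εL)
    (hY : ∀ x, Y x = D.mulVec Γ x + E x)
    (F : (Fin M → ℝ) → ℝ)
    (hF : ∀ v, F v = (1 / 2) * (∑ x, (Y x - D.mulVec v x) ^ 2) + 4 * εL * (∑ i, |v i|))
    (ΓBP : Fin M → ℝ) (hmin : ∀ v, F ΓBP ≤ F v) :
    (∀ i, ΓBP i ≠ 0 → Γ i ≠ 0) ∧
    (∀ i, |ΓBP i - Γ i| < (15 / 2) * εL) ∧
    (∀ i, |Γ i| > (15 / 2) * εL → ΓBP i ≠ 0) ∧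
    (∀ v, (∀ w, F v ≤ F w) → v = ΓBP) := by
  obtain rfl : F = fun v => (1 / 2) * (∑ x, (Y x - D.mulVec v x) ^ 2) + 4 * εL * (∑ i, |v i|) :=
    funext hF
  obtain rfl : Y = fun x => D.mulVec Γ x + E x := funext hY
  clear hF hY
  set G : Fin M → Fin M → ℝ := fun i j => ∑ x, D x i * D x j with hG
  have hdiag : ∀ i, G i i = 1 := fun i => by rw [← hnorm i]; simp [hG, sq]
  have hsymm : ∀ i j, G i j = G j i := fun i j => by simp [hG, mul_comm]
  have hΓ : ∀ i ∉ T, Γ i = 0 := fun i hi => by_contra fun h => hi ((hT i).1 h)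
  have hkμ : 3 * (k * μ) < 1 + μ := by
    have := mul_lt_mul_of_pos_right hk hμ
    field_simp at this
    linarith
  set ρ : ℝ := (k - 1) * μ with hρ
  have hρ1 : ρ < 1 / 3 := by rw [hρ]; linarith
  have hdom : ∀ j ∈ T, ∑ t ∈ T.erase j, |G t j| ≤ ρ := by
    intro j hj
    refine (sum_abs_le_natCard_mul (T.erase j) (fun t => G t j)
      (fun t => t ∈ T ∧ t ≠ j ∧ G t j ≠ 0) (fun t => by simp only [Finset.mem_erase]; tauto)
      fun t ht => hcoh t j (Finset.ne_of_mem_erase ht)).trans ?_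
    refine mul_le_mul_of_nonneg_right ?_ hμ.le
    rw [le_sub_iff_add_le]
    exact_mod_cast hin j hj
  have hdomout : ∀ j ∉ T, ∑ t ∈ T, |G t j| ≤ k * μ := by
    intro j hj
    refine (sum_abs_le_natCard_mul T (fun t => G t j) (fun t => t ∈ T ∧ G t j ≠ 0)
      (fun t => Iff.rfl) fun t ht => hcoh t j fun h => hj (h ▸ ht)).trans ?_
    exact mul_le_mul_of_nonneg_right (by exact_mod_cast hout j hj) hμ.le
  have hsupp : ∀ v : Fin M → ℝ,
      (∀ w, (1 / 2) * (∑ x, (D.mulVec Γ x + E x - D.mulVec v x) ^ 2) + 4 * εL * (∑ i, |v i|)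
        ≤ (1 / 2) * (∑ x, (D.mulVec Γ x + E x - D.mulVec w x) ^ 2) + 4 * εL * (∑ i, |w i|)) →
      ∀ i ∉ T, v i = 0 := by
    intro v hv
    obtain ⟨a, ha, hsol⟩ := exists_supported_solution hdiag
      (fun j hj => (hdom j hj).trans_lt (by linarith)) (fun i => ∑ j ∈ Tᶜ, v j * G j i)
    set W := ∑ j ∈ Tᶜ, |v j| with hW
    set A := ∑ i ∈ T, |a i| with hA
    have hAW : A * (1 - ρ) ≤ k * μ * W := by
      refine (sum_abs_mul_one_sub_le hdiag hsymm hdom ha).trans ?_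
      calc ∑ i ∈ T, |∑ t, a t * G t i| ≤ ∑ i ∈ T, ∑ j ∈ Tᶜ, |v j| * |G i j| := by
            refine Finset.sum_le_sum fun i hi => ?_
            rw [hsol i hi]
            refine (Finset.abs_sum_le_sum_abs _ _).trans_eq ?_
            exact Finset.sum_congr rfl fun j _ => by rw [abs_mul, hsymm]
        _ = ∑ j ∈ Tᶜ, |v j| * ∑ i ∈ T, |G i j| := by
            rw [Finset.sum_comm]; simp_rw [Finset.mul_sum]
        _ ≤ ∑ j ∈ Tᶜ, |v j| * (k * μ) := Finset.sum_le_sum fun j hj =>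
            mul_le_mul_of_nonneg_left (hdomout j (Finset.mem_compl.1 hj)) (abs_nonneg _)
        _ = k * μ * W := by rw [← Finset.sum_mul, mul_comm]
    have hW0 : 0 ≤ W := Finset.sum_nonneg fun _ _ => abs_nonneg _
    have hhalf : A ≤ W / 2 := by
      have : k * μ ≤ (1 - ρ) / 2 := by rw [hρ]; linarith
      have h2 := mul_le_mul_of_nonneg_right this hW0
      refine le_of_mul_le_mul_right ?_ (show 0 < 1 - ρ by linarith)
      linarith
    set z : Fin M → ℝ := fun i => if i ∈ T then -a i else v i with hz
    have hsplit : ∀ f : Fin M → ℝ, ∑ i, f i = ∑ i ∈ T, f i + ∑ i ∈ Tᶜ, f i :=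
      fun f => (Finset.sum_add_sum_compl T f).symm
    have horth : ∀ i ∈ T, ∑ t, z t * G t i = 0 := by
      intro i hi
      have h := hsol i hi
      rw [hsplit, Finset.sum_eq_zero (s := Tᶜ) fun t ht => by
        rw [ha t (Finset.mem_compl.1 ht), zero_mul]] at h
      rw [hsplit, Finset.sum_congr rfl fun t ht => by
        rw [show z t = -a t from if_pos ht], Finset.sum_congr (s₁ := Tᶜ) rfl fun t ht => by
        rw [show z t = v t from if_neg (Finset.mem_compl.1 ht)]]
      simp only [neg_mul, Finset.sum_neg_distrib]
      linarith
    have hz1 : ∑ i, |z i| = A + W := by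
      rw [hsplit, hA, hW]
      congr 1
      · exact Finset.sum_congr rfl fun t ht => by simp [hz, ht]
      · exact Finset.sum_congr rfl fun t ht => by simp [hz, Finset.mem_compl.1 ht]
    have hvz : ∑ i, |(v - z) i| ≤ ∑ i, |v i| - W + A := by
      rw [hsplit, hsplit fun i => |v i|, Finset.sum_eq_zero (s := Tᶜ) fun t ht => by
        simp [hz, Finset.mem_compl.1 ht]]
      have : ∑ i ∈ T, |(v - z) i| ≤ ∑ i ∈ T, (|v i| + |a i|) :=
        Finset.sum_le_sum fun i hi => by simpa [hz, hi] using abs_add_le (v i) (a i)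
      rw [Finset.sum_add_distrib] at this
      linarith
    have hcross : ∑ x, (D.mulVec Γ x + E x - D.mulVec (v - z) x) * D.mulVec z x
        ≤ εL * (A + W) := by
      have h0 : ∑ x, D.mulVec z x * D.mulVec (Γ - (v - z)) x = 0 := by
        rw [sum_mul_mulVec]
        refine Finset.sum_eq_zero fun i _ => ?_
        by_cases hi : i ∈ T
        · rw [sum_mul_mulVec_eq_gram, horth i hi, mul_zero]
        · simp [hΓ i hi, hz, hi]
      have h1 : ∑ x, E x * D.mulVec z x ≤ εL * (A + W) := by
        rw [sum_mul_mulVec, ← hz1, Finset.mul_sum]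
        refine Finset.sum_le_sum fun i _ => (le_abs_self _).trans ?_
        rw [abs_mul, mul_comm]
        exact mul_le_mul_of_nonneg_right (hE i) (abs_nonneg _)
      refine le_of_eq_of_le ?_ h1
      rw [← add_zero (∑ x, E x * _), ← h0, ← Finset.sum_add_distrib]
      refine Finset.sum_congr rfl fun x _ => ?_
      rw [Matrix.mulVec_sub D Γ, Pi.sub_apply]
      ring
    have hle := hv (v - z)
    have hexp := sum_sub_mulVec_add_sq D (fun x => D.mulVec Γ x + E x) (v - z) z
    rw [sub_add_cancel] at hexp
    have hsq : 0 ≤ ∑ x, D.mulVec z x ^ 2 := Finset.sum_nonneg fun _ _ => sq_nonneg _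
    have hWle : W ≤ 0 := by
      have hl1 := mul_le_mul_of_nonneg_left hvz (show 0 ≤ 4 * εL by linarith)
      have hA' := mul_le_mul_of_nonneg_left hhalf hεL.le
      have : εL * W ≤ εL * 0 := by linarith
      exact le_of_mul_le_mul_left this hεL
    intro i hi
    have := Finset.single_le_sum (f := fun j => |v j|) (fun _ _ => abs_nonneg _)
      (Finset.mem_compl.2 hi)
    exact abs_nonpos_iff.1 (this.trans hWle)
  have hBP := hsupp ΓBP hmin
  have hbound : ∀ i, |ΓBP i - Γ i| < (15 / 2) * εL := by
    intro i
    by_cases hi : i ∈ T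
    · have h := abs_mul_one_sub_le hdiag (by linarith) hdom (a := ΓBP - Γ) (C := 5 * εL)
        (fun i hi => by simp [hBP i hi, hΓ i hi]) (fun i _ => ?_) i hi
      · have : |ΓBP i - Γ i| * (1 - ρ) ≤ 5 * εL := h
        nlinarith [abs_nonneg (ΓBP i - Γ i)]
      · have hres := abs_sum_mul_residual_le D hnorm (by linarith) hmin i
        have heq : ∑ t, (ΓBP - Γ) t * G t i
            = ∑ x, D x i * E x - ∑ x, D x i * (D.mulVec Γ x + E x - D.mulVec ΓBP x) := by
          rw [← sum_mul_mulVec_eq_gram, ← Finset.sum_sub_distrib, Matrix.mulVec_sub]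
          exact Finset.sum_congr rfl fun x _ => by rw [Pi.sub_apply]; ring
        rw [heq]
        refine (abs_sub _ _).trans ?_
        linarith [hE i]
    · rw [hBP i hi, hΓ i hi, sub_zero, abs_zero]
      positivity
  refine ⟨fun i hi => (hT i).2 (by_contra fun h => hi (hBP i h)), hbound, fun i hi h => ?_,
    fun v hv => ?_⟩
  · have := hbound i
    rw [h, zero_sub, abs_neg] at this
    linarith
  · have hvT := hsupp v hv
    -- strict convexity along the segment joining the two minimizers
    set u : Fin M → ℝ := (1 / 2 : ℝ) • (v - ΓBP) with hu
    have e1 := sum_sub_mulVec_add_sq D (fun x => D.mulVec Γ x + E x) (ΓBP + u) u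
    have e2 := sum_sub_mulVec_add_sq D (fun x => D.mulVec Γ x + E x) (ΓBP + u) (-u)
    have hv' : ΓBP + u + u = v := by ext i; simp [hu]; ring
    rw [hv'] at e1
    simp only [add_neg_cancel_right, Matrix.mulVec_neg, Pi.neg_apply, mul_neg, neg_sq,
      Finset.sum_neg_distrib] at e2
    have hl1 : 2 * ∑ i, |(ΓBP + u) i| ≤ ∑ i, |v i| + ∑ i, |ΓBP i| := by
      rw [Finset.mul_sum, ← Finset.sum_add_distrib]
      refine Finset.sum_le_sum fun i _ => ?_
      have : 2 * (ΓBP + u) i = v i + ΓBP i := by simp [hu]; ring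
      rw [← abs_two, ← abs_mul, this]
      simpa using abs_add_le (v i) (ΓBP i)
    have hm1 := hmin (ΓBP + u)
    have hm2 := hv (ΓBP + u)
    have hsq : ∑ x, D.mulVec u x ^ 2 ≤ 0 := by
      have := mul_le_mul_of_nonneg_left hl1 (show 0 ≤ 4 * εL by linarith)
      linarith
    have hDu : ∀ x, D.mulVec u x = 0 := fun x => by
      have := Finset.single_le_sum (f := fun x => D.mulVec u x ^ 2) (fun _ _ => sq_nonneg _)
        (Finset.mem_univ x)
      exact pow_eq_zero_iff two_ne_zero |>.1 (le_antisymm (this.trans hsq) (sq_nonneg _))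
    have huT : ∀ i ∉ T, u i = 0 := fun i hi => by simp [hu, hvT i hi, hBP i hi]
    have hu0 : ∀ i, u i = 0 := fun i => by
      by_cases hi : i ∈ T
      · have h := abs_mul_one_sub_le hdiag (by linarith) hdom huT (C := 0)
          (fun i _ => by rw [← sum_mul_mulVec_eq_gram]; simp [hDu]) i hi
        exact abs_nonpos_iff.1 (by nlinarith [abs_nonneg (u i)])
      · exact huT i hi
    ext i
    have := hu0 i
    simp only [hu, Pi.smul_apply, Pi.sub_apply, smul_eq_mul] at this
    linarith
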